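/- Every relation ρ ⊆ {0,1}^n that is preserved by the majority operation mjy is A-reducible to the 2-SAT template Γ_2SAT, i.e. ρ is a finite intersection of n-ary relations each of which is strongly reducible to Γ_2SAT. -/

import Mathlib

/-- A relation on `{0,1}^m` is preserved by the majority operation
`mjy(x,y,z) = (x∧y) ∨ (x∧z) ∨ (y∧z)` applied componentwise. -/
def MjyClosed {m : ℕ} (σ : Set (Fin m → Bool)) : Prop :=
  ∀ x ∈ σ, ∀ y ∈ σ, ∀ z ∈ σ,
    (fun i => (x i && y i) || (x i && z i) || (y i && z i)) ∈ σ

/-- Projection of a relation on `{0,1}^m` to the first `k` coordinates. -/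
def projFirst {m k : ℕ} (h : k ≤ m) (σ : Set (Fin m → Bool)) : Set (Fin k → Bool) :=
  {y | ∃ x ∈ σ, ∀ i : Fin k, x (Fin.castLE h i) = y i}

/-- The solution set of a constraint family over the 2-SAT template
`Γ_2SAT = ({0,1}, ϱ₁, ϱ₂, ϱ₃)` on `m` variables, where `C1, C2, C3` are the finite sets
of scopes of constraints with relations `ϱ₁ = {x ∨ y}`, `ϱ₂ = {¬x ∨ y}`,
`ϱ₃ = {¬x ∨ ¬y}` respectively. -/
def TwoSatSol {m : ℕ} (C1 C2 C3 : Finset (Fin m × Fin m)) : Set (Fin m → Bool) :=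
  {x | (∀ c ∈ C1, (x c.1 || x c.2) = true) ∧
       (∀ c ∈ C2, ((!x c.1) || x c.2) = true) ∧
       (∀ c ∈ C3, ((!x c.1) || (!x c.2)) = true)}

/-- `σ ⊆ {0,1}^k` is strongly reducible to the 2-SAT template. -/
def StronglyReducible2SAT {k : ℕ} (σ : Set (Fin k → Bool)) : Prop :=
  ∃ (m : ℕ) (h : k ≤ m) (C1 C2 C3 : Finset (Fin m × Fin m)) (δ : Set (Fin m → Bool)),
    projFirst h (TwoSatSol C1 C2 C3) = σ ∧ projFirst h δ = σᶜ ∧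
    MjyClosed (TwoSatSol C1 C2 C3 ∪ δ)

/-- `ρ ⊆ {0,1}^k` is A-reducible to the 2-SAT template: a finite intersection of
relations strongly reducible to it. -/
def AReducible2SAT {k : ℕ} (ρ : Set (Fin k → Bool)) : Prop :=
  ∃ (l : ℕ) (ρs : Fin l → Set (Fin k → Bool)),
    (∀ i, StronglyReducible2SAT (ρs i)) ∧ ρ = ⋂ i, ρs i

/-- A nonempty relation preserved by majority contains every tuple that it matches on
all pairs of coordinates. -/
theorem MjyClosed.mem_of_forall_pair {n : ℕ} {ρ : Set (Fin n → Bool)} (h : MjyClosed ρ)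
    (hne : ρ.Nonempty) {x : Fin n → Bool}
    (hx : ∀ i j, ∃ y ∈ ρ, y i = x i ∧ y j = x j) : x ∈ ρ := by
  have key : ∀ S : Finset (Fin n), ∃ y ∈ ρ, ∀ i ∈ S, y i = x i := by
    intro S
    induction S using Finset.strongInduction with
    | H S ih =>
      rcases Nat.lt_or_ge 2 S.card with hc | hc
      · obtain ⟨a, b, c, ha, hb, hc, hab, hac, hbc⟩ := Finset.two_lt_card_iff.1 hc
        obtain ⟨u, hu, hu'⟩ := ih _ (Finset.erase_ssubset ha)
        obtain ⟨v, hv, hv'⟩ := ih _ (Finset.erase_ssubset hb)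
        obtain ⟨w, hw, hw'⟩ := ih _ (Finset.erase_ssubset hc)
        refine ⟨_, h u hu v hv w hw, fun i hi => ?_⟩
        have eu : i ≠ a → u i = x i := fun hia => hu' i (Finset.mem_erase.2 ⟨hia, hi⟩)
        have ev : i ≠ b → v i = x i := fun hib => hv' i (Finset.mem_erase.2 ⟨hib, hi⟩)
        have ew : i ≠ c → w i = x i := fun hic => hw' i (Finset.mem_erase.2 ⟨hic, hi⟩)
        by_cases hia : i = a
        · subst hia
          simp only [ev hab, ew hac]
          cases x i <;> simp
        · by_cases hib : i = b
          · subst hib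
            simp only [eu hia, ew hbc]
            cases x i <;> simp
          · simp only [eu hia, ev hib]
            cases x i <;> simp
      · rcases S.eq_empty_or_nonempty with rfl | ⟨a, ha⟩
        · obtain ⟨y, hy⟩ := hne
          exact ⟨y, hy, by simp⟩
        · have hcard : (S.erase a).card ≤ 1 := by
            rw [Finset.card_erase_of_mem ha]
            omega
          have : Nonempty (Fin n) := ⟨a⟩
          obtain ⟨b, hb⟩ := Finset.card_le_one_iff_subset_singleton.1 hcard
          obtain ⟨y, hy, hya, hyb⟩ := hx a b
          refine ⟨y, hy, fun i hi => ?_⟩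
          by_cases hia : i = a
          · rw [hia, hya]
          · rw [Finset.mem_singleton.1 (hb (Finset.mem_erase.2 ⟨hia, hi⟩)), hyb]
  obtain ⟨y, hy, hyx⟩ := key Finset.univ
  rwa [← funext fun i => hyx i (Finset.mem_univ i)]

/-- A nonempty relation preserved by majority is the solution set of a 2-SAT instance. -/
theorem MjyClosed.exists_twoSatSol {n : ℕ} {ρ : Set (Fin n → Bool)} (h : MjyClosed ρ)
    (hne : ρ.Nonempty) :
    ∃ C1 C2 C3 : Finset (Fin n × Fin n), TwoSatSol C1 C2 C3 = ρ := by
  classical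
  refine ⟨Finset.univ.filter fun c => ∀ y ∈ ρ, (y c.1 || y c.2) = true,
    Finset.univ.filter fun c => ∀ y ∈ ρ, ((!y c.1) || y c.2) = true,
    Finset.univ.filter fun c => ∀ y ∈ ρ, ((!y c.1) || (!y c.2)) = true,
    Set.Subset.antisymm (fun x hx => h.mem_of_forall_pair hne fun i j => ?_)
      fun x hx => ⟨fun c hc => (Finset.mem_filter.1 hc).2 x hx,
        fun c hc => (Finset.mem_filter.1 hc).2 x hx,
        fun c hc => (Finset.mem_filter.1 hc).2 x hx⟩⟩
  obtain ⟨h1, h2, h3⟩ := hx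
  by_contra! hno
  simp only [Finset.mem_filter, Finset.mem_univ, true_and] at h1 h2 h3
  have h1 := h1 (i, j)
  have h2 := And.intro (h2 (i, j)) (h2 (j, i))
  have h3 := h3 (i, j)
  cases hi : x i <;> cases hj : x j <;> simp only [hi, hj] at h1 h2 h3 hno <;> grind

/-- The solution set of a 2-SAT instance is strongly reducible to the 2-SAT template. -/
theorem stronglyReducible2SAT_twoSatSol {n : ℕ} (C1 C2 C3 : Finset (Fin n × Fin n)) :
    StronglyReducible2SAT (TwoSatSol C1 C2 C3) := by
  have proj_self : ∀ σ : Set (Fin n → Bool), projFirst le_rfl σ = σ := fun σ =>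
    Set.ext fun y => ⟨fun ⟨x, hx, hxy⟩ => (funext hxy : x = y) ▸ hx,
      fun hy => ⟨y, hy, fun _ => rfl⟩⟩
  refine ⟨n, le_rfl, C1, C2, C3, (TwoSatSol C1 C2 C3)ᶜ, proj_self _, proj_self _, ?_⟩
  rw [Set.union_compl_self]
  exact fun _ _ _ _ _ _ => Set.mem_univ _

/-- The empty relation is strongly reducible to the 2-SAT template, in every arity. -/
theorem stronglyReducible2SAT_empty (n : ℕ) :
    StronglyReducible2SAT (∅ : Set (Fin n → Bool)) := by
  have hsol : TwoSatSol {(Fin.last n, Fin.last n)} ∅ {(Fin.last n, Fin.last n)} = ∅ :=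
    Set.eq_empty_of_forall_notMem fun x hx => by simp_all [TwoSatSol]
  refine ⟨n + 1, n.le_succ, {(Fin.last n, Fin.last n)}, ∅, {(Fin.last n, Fin.last n)},
    Set.univ, ?_, ?_, ?_⟩
  · simp [hsol, projFirst]
  · rw [Set.compl_empty]
    exact Set.eq_univ_of_forall fun y =>
      ⟨Fin.snoc (α := fun _ => Bool) y false, Set.mem_univ _, fun i =>
        Fin.snoc_castSucc (α := fun _ => Bool) false y i⟩
  · rw [Set.union_univ]
    exact fun _ _ _ _ _ _ => Set.mem_univ _

/-- Every relation on `{0,1}^n` preserved by the majority operation is A-reducible to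
the 2-SAT template. -/
theorem stmt13 (n : ℕ) (ρ : Set (Fin n → Bool)) (h : MjyClosed ρ) :
    AReducible2SAT ρ := by
  refine ⟨1, fun _ => ρ, fun _ => ?_, (Set.iInter_const ρ).symm⟩
  rcases ρ.eq_empty_or_nonempty with rfl | hne
  · exact stronglyReducible2SAT_empty n
  · obtain ⟨C1, C2, C3, rfl⟩ := h.exists_twoSatSol hne
    exact stronglyReducible2SAT_twoSatSol C1 C2 C3
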